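/- Let N ≥ 1 and let D_0, …, D_{N−1} be nonempty compact sets of real n×n matrices. Call a sequence (x_t) in ℝⁿ admissible if for every m ∈ ℕ and every k ∈ {1,…,N} there exists Φ ∈ D_{k−1} with x_{mN+k} = Φ x_{mN}. Then the following are equivalent: (a) every admissible sequence satisfies x_t → 0 as t → ∞ (asymptotic attractivity, for every initial state x₀); (b) there exist c ≥ 1 and λ ∈ (0,1) such that every admissible sequence satisfies ‖x_t‖ ≤ c λ^t ‖x₀‖ for all t ∈ ℕ (exponential stability). -/

import Mathlib

open Matrix

/-- Euclidean norm on `Fin n → ℝ`. -/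
noncomputable def eNorm {n : ℕ} (x : Fin n → ℝ) : ℝ := Real.sqrt (∑ i, x i ^ 2)

open Filter Topology

theorem abs_le_eNorm {n : ℕ} (x : Fin n → ℝ) (i : Fin n) : |x i| ≤ eNorm x := by
  rw [← Real.sqrt_sq_eq_abs]
  exact Real.sqrt_le_sqrt
    (Finset.single_le_sum (f := fun i => x i ^ 2) (fun j _ => sq_nonneg _) (Finset.mem_univ i))

theorem eNorm_nonneg {n : ℕ} (x : Fin n → ℝ) : 0 ≤ eNorm x := Real.sqrt_nonneg _

theorem norm_le_eNorm {n : ℕ} (x : Fin n → ℝ) : ‖x‖ ≤ eNorm x :=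
  (pi_norm_le_iff_of_nonneg (eNorm_nonneg x)).2 fun i => abs_le_eNorm x i

theorem eNorm_le_mul_norm {n : ℕ} (x : Fin n → ℝ) : eNorm x ≤ √n * ‖x‖ := by
  have h : ∑ i, x i ^ 2 ≤ n * ‖x‖ ^ 2 := by
    have : ∑ i, x i ^ 2 ≤ ∑ _i : Fin n, ‖x‖ ^ 2 := Finset.sum_le_sum fun i _ =>
      sq_le_sq.2 (by simpa using norm_le_pi_norm x i)
    simpa using this
  calc eNorm x ≤ √(n * ‖x‖ ^ 2) := Real.sqrt_le_sqrt h
    _ = √n * ‖x‖ := by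
      rw [Real.sqrt_mul (Nat.cast_nonneg n), Real.sqrt_sq (norm_nonneg x)]

/-- A compact set of matrices is uniformly bounded as a set of operators. -/
theorem IsCompact.exists_norm_mulVec_le {n : ℕ} {A : Set (Matrix (Fin n) (Fin n) ℝ)}
    (hA : IsCompact A) :
    ∃ L : ℝ, 1 ≤ L ∧ ∀ Φ ∈ A, ∀ v : Fin n → ℝ, ‖Φ *ᵥ v‖ ≤ L * ‖v‖ := by
  obtain ⟨C, hC⟩ := hA.exists_bound_of_continuousOn
    (f := fun Φ : Matrix (Fin n) (Fin n) ℝ => ∑ i, ∑ j, |Φ i j|) (by fun_prop)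
  refine ⟨max 1 C, le_max_left _ _, fun Φ hΦ v => ?_⟩
  refine (pi_norm_le_iff_of_nonneg (by positivity)).2 fun i => ?_
  calc ‖(Φ *ᵥ v) i‖ ≤ ∑ j, ‖Φ i j * v j‖ := by
        rw [mulVec_eq_sum, Finset.sum_apply]
        simpa [mul_comm] using norm_sum_le Finset.univ fun j => Φ i j * v j
    _ ≤ ∑ j, |Φ i j| * ‖v‖ := Finset.sum_le_sum fun j _ => by
        rw [norm_mul]
        exact mul_le_mul_of_nonneg_left (norm_le_pi_norm v j) (norm_nonneg _)
    _ = (∑ j, |Φ i j|) * ‖v‖ := (Finset.sum_mul ..).symm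
    _ ≤ (∑ i, ∑ j, |Φ i j|) * ‖v‖ := by
        refine mul_le_mul_of_nonneg_right ?_ (norm_nonneg v)
        exact Finset.single_le_sum (f := fun i => ∑ j, |Φ i j|)
          (fun _ _ => by positivity) (Finset.mem_univ i)
    _ ≤ max 1 C * ‖v‖ := by
        gcongr
        exact (le_abs_self _).trans ((hC Φ hΦ).trans (le_max_right _ _))

/-- The trajectory of the switched linear system driven by the matrices `Φ 0, Φ 1, …`. -/
def switchedTrajectory {n : ℕ} (Φ : ℕ → Matrix (Fin n) (Fin n) ℝ) (v : Fin n → ℝ) :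
    ℕ → Fin n → ℝ
  | 0 => v
  | m + 1 => Φ m *ᵥ switchedTrajectory Φ v m

theorem continuous_switchedTrajectory {n : ℕ} (m : ℕ) :
    Continuous fun p : (Fin n → ℝ) × (ℕ → Matrix (Fin n) (Fin n) ℝ) =>
      switchedTrajectory p.2 p.1 m := by
  induction m with
  | zero => exact continuous_fst
  | succ m ih => exact ((continuous_apply m).comp continuous_snd).matrix_mulVec ih

/-- Attractivity of all trajectories of a switched linear system with compactly many modes makes
every trajectory halve its norm within a uniform time. -/
theorem exists_uniform_halving_time {n : ℕ} {A : Set (Matrix (Fin n) (Fin n) ℝ)}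
    (hA : IsCompact A)
    (h : ∀ Φ : ℕ → Matrix (Fin n) (Fin n) ℝ, (∀ m, Φ m ∈ A) → ∀ v,
      Tendsto (switchedTrajectory Φ v) atTop (𝓝 0)) :
    ∃ M, 1 ≤ M ∧ ∀ y : ℕ → Fin n → ℝ, (∀ m, ∃ Φ ∈ A, y (m + 1) = Φ *ᵥ y m) →
      ∃ p, 1 ≤ p ∧ p ≤ M ∧ ‖y p‖ ≤ 1 / 2 * ‖y 0‖ := by
  have hK : IsCompact (Metric.sphere (0 : Fin n → ℝ) 1 ×ˢ
      Set.univ.pi fun _ : ℕ => A) := (isCompact_sphere 0 1).prod (isCompact_univ_pi fun _ => hA)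
  obtain ⟨s, hs⟩ := hK.elim_finite_subcover
    (fun m : ℕ => {p : (Fin n → ℝ) × (ℕ → Matrix (Fin n) (Fin n) ℝ) |
      ‖switchedTrajectory p.2 p.1 m‖ < 1 / 2})
    (fun m => isOpen_lt (continuous_switchedTrajectory m).norm continuous_const) (by
      rintro ⟨v, Φ⟩ ⟨-, hΦ⟩
      have := (h Φ (fun m => hΦ m trivial) v).norm
      rw [norm_zero] at this
      obtain ⟨m, hm⟩ := (this.eventually (gt_mem_nhds one_half_pos)).exists
      exact Set.mem_iUnion.2 ⟨m, hm⟩)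
  refine ⟨s.sup id + 1, by omega, fun y hy => ?_⟩
  choose Φ hΦ hy using hy
  by_cases h0 : y 0 = 0
  · exact ⟨1, le_rfl, by omega, by simp [hy 0, h0]⟩
  have hpos : 0 < ‖y 0‖ := norm_pos_iff.2 h0
  have htraj : ∀ m, switchedTrajectory Φ (‖y 0‖⁻¹ • y 0) m = ‖y 0‖⁻¹ • y m := by
    intro m
    induction m with
    | zero => rfl
    | succ m ih => rw [switchedTrajectory, ih, mulVec_smul, hy m]
  have hmem : ((‖y 0‖⁻¹ • y 0, Φ) : (Fin n → ℝ) × (ℕ → Matrix (Fin n) (Fin n) ℝ)) ∈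
      Metric.sphere (0 : Fin n → ℝ) 1 ×ˢ Set.univ.pi fun _ : ℕ => A :=
    ⟨by simp [norm_smul, hpos.ne'], fun m _ => hΦ m⟩
  obtain ⟨p, hps, hp⟩ := Set.mem_iUnion₂.1 (hs hmem)
  have hp : ‖y 0‖⁻¹ * ‖y p‖ < 1 / 2 := by
    simpa [htraj, norm_smul] using hp
  have hp' : ‖y p‖ < 1 / 2 * ‖y 0‖ := by
    rwa [inv_mul_lt_iff₀ hpos, mul_comm] at hp
  refine ⟨p, Nat.one_le_iff_ne_zero.2 ?_, (Finset.le_sup (f := id) hps).trans (by simp), hp'.le⟩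
  rintro rfl
  linarith

/-- Halving the norm within uniform time yields geometric decay. -/
theorem norm_le_of_uniform_halving {n : ℕ} {A : Set (Matrix (Fin n) (Fin n) ℝ)} {L μ : ℝ}
    {M : ℕ} (hL : 1 ≤ L) (hμ : 0 < μ) (hμ1 : μ ≤ 1) (hμM : μ ^ M = 1 / 2)
    (hbound : ∀ Φ ∈ A, ∀ v : Fin n → ℝ, ‖Φ *ᵥ v‖ ≤ L * ‖v‖)
    (hhalf : ∀ y : ℕ → Fin n → ℝ, (∀ m, ∃ Φ ∈ A, y (m + 1) = Φ *ᵥ y m) →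
      ∃ p, 1 ≤ p ∧ p ≤ M ∧ ‖y p‖ ≤ 1 / 2 * ‖y 0‖) (m : ℕ) :
    ∀ y : ℕ → Fin n → ℝ, (∀ m, ∃ Φ ∈ A, y (m + 1) = Φ *ᵥ y m) →
      ‖y m‖ ≤ 2 * L ^ M * μ ^ m * ‖y 0‖ := by
  induction m using Nat.strong_induction_on with
  | _ m ih =>
    intro y hy
    rcases lt_or_ge m M with hm | hm
    · have hgrow : ∀ k, ‖y k‖ ≤ L ^ k * ‖y 0‖ := by
        intro k
        induction k with
        | zero => simp
        | succ k ihk =>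
          obtain ⟨Φ, hΦ, hk⟩ := hy k
          rw [hk, pow_succ', mul_assoc]
          exact (hbound Φ hΦ _).trans (by gcongr)
      have h1 : L ^ m ≤ L ^ M := pow_le_pow_right₀ hL hm.le
      have h2 : 1 / 2 ≤ μ ^ m := hμM ▸ pow_le_pow_of_le_one hμ.le hμ1 hm.le
      calc ‖y m‖ ≤ L ^ m * ‖y 0‖ := hgrow m
        _ ≤ 2 * L ^ M * (1 / 2) * ‖y 0‖ := by
          gcongr
          linarith
        _ ≤ 2 * L ^ M * μ ^ m * ‖y 0‖ := by gcongr
    · obtain ⟨p, hp1, hpM, hp⟩ := hhalf y hy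
      have hshift := ih (m - p) (by omega) (fun k => y (p + k)) fun k => hy (p + k)
      simp only [Nat.add_sub_cancel' (hpM.trans hm), add_zero] at hshift
      have h2 : 1 / 2 ≤ μ ^ p := hμM ▸ pow_le_pow_of_le_one hμ.le hμ1 hpM
      calc ‖y m‖ ≤ 2 * L ^ M * μ ^ (m - p) * ‖y p‖ := hshift
        _ ≤ 2 * L ^ M * μ ^ (m - p) * (μ ^ p * ‖y 0‖) := by
          gcongr
          exact hp.trans (by gcongr)
        _ = 2 * L ^ M * (μ ^ (m - p) * μ ^ p) * ‖y 0‖ := by ring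
        _ = 2 * L ^ M * μ ^ m * ‖y 0‖ := by
          rw [← pow_add, Nat.sub_add_cancel (hpM.trans hm)]

/-- Every trajectory of the system sampled at multiples of `N` extends to an admissible
sequence. -/
theorem exists_admissible_extension {n N : ℕ} (hN : 1 ≤ N)
    {D : ℕ → Set (Matrix (Fin n) (Fin n) ℝ)} (hne : ∀ k, k < N → (D k).Nonempty)
    {y : ℕ → Fin n → ℝ} (hy : ∀ m, ∃ Φ ∈ D (N - 1), y (m + 1) = Φ *ᵥ y m) :
    ∃ x : ℕ → Fin n → ℝ,
      (∀ m k : ℕ, k < N → ∃ Φ ∈ D k, x (m * N + k + 1) = Φ *ᵥ x (m * N)) ∧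
      ∀ m, x (m * N) = y m := by
  choose! Ψ hΨ using hne
  let x : ℕ → Fin n → ℝ := fun t =>
    if t % N = 0 then y (t / N) else Ψ (t % N - 1) *ᵥ y (t / N)
  have hx : ∀ m, x (m * N) = y m := fun m => by
    simp [x, Nat.mul_div_cancel m hN]
  refine ⟨x, fun m k hk => ?_, hx⟩
  rw [hx]
  rcases eq_or_ne (k + 1) N with h | h
  · obtain ⟨Φ, hΦ, hm⟩ := hy m
    refine ⟨Φ, by rwa [← h] at hΦ, ?_⟩
    rw [← hm, ← hx, add_mul, one_mul, add_assoc, h]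
  · have hlt : k + 1 < N := by omega
    refine ⟨Ψ k, hΨ k hk, ?_⟩
    have hmod : (m * N + k + 1) % N = k + 1 := by
      rw [add_assoc, Nat.mul_add_mod_self_right, Nat.mod_eq_of_lt hlt]
    have hdiv : (m * N + k + 1) / N = m := by
      rw [add_assoc, mul_comm, Nat.mul_add_div hN, Nat.div_eq_of_lt hlt, add_zero]
    simp only [x, hmod, hdiv]
    simp

theorem stmt_18 (n : ℕ) (hn : 0 < n) (N : ℕ) (hN : 1 ≤ N)
    (D : ℕ → Set (Matrix (Fin n) (Fin n) ℝ))
    (hne : ∀ k, k < N → (D k).Nonempty)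
    (hcomp : ∀ k, k < N → IsCompact (D k)) :
    -- asymptotic attractivity of every admissible sequence
    (∀ x : ℕ → Fin n → ℝ,
      (∀ m k : ℕ, k < N → ∃ Φ ∈ D k, x (m * N + k + 1) = Φ.mulVec (x (m * N))) →
      Filter.Tendsto x Filter.atTop (nhds 0)) ↔
    -- exponential stability, uniformly over admissible sequences
    (∃ c : ℝ, 1 ≤ c ∧ ∃ lam : ℝ, lam ∈ Set.Ioo (0 : ℝ) 1 ∧
      ∀ x : ℕ → Fin n → ℝ,
        (∀ m k : ℕ, k < N → ∃ Φ ∈ D k, x (m * N + k + 1) = Φ.mulVec (x (m * N))) →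
        ∀ t, eNorm (x t) ≤ c * lam ^ t * eNorm (x 0)) := by
  constructor
  · intro hattr
    have hlast : N - 1 < N := by omega
    obtain ⟨M, hM, hhalf⟩ := exists_uniform_halving_time (hcomp _ hlast) fun Φ hΦ v => by
      obtain ⟨x, hx, hxy⟩ := exists_admissible_extension hN hne
        (y := switchedTrajectory Φ v) fun m => ⟨Φ m, hΦ m, rfl⟩
      exact ((hattr x hx).comp (tendsto_id.atTop_mul_const' hN)).congr hxy
    obtain ⟨L, hL, hbound⟩ := ((Finset.range N).isCompact_biUnion fun k hk =>
      hcomp k (Finset.mem_range.1 hk)).exists_norm_mulVec_le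
    have hbound : ∀ k < N, ∀ Φ ∈ D k, ∀ v : Fin n → ℝ, ‖Φ *ᵥ v‖ ≤ L * ‖v‖ :=
      fun k hk Φ hΦ => hbound Φ (Set.mem_biUnion (Finset.mem_coe.2 (Finset.mem_range.2 hk)) hΦ)
    obtain ⟨lam, hlam0, hlam⟩ : ∃ lam : ℝ, 0 < lam ∧ lam ^ (N * M) = 1 / 2 :=
      ⟨(1 / 2 : ℝ) ^ ((N * M : ℕ) : ℝ)⁻¹, by positivity,
        Real.rpow_inv_natCast_pow (by norm_num) (by positivity)⟩
    have hlam1 : lam < 1 := by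
      by_contra! hge
      have := one_le_pow₀ hge (n := N * M)
      norm_num [hlam] at this
    have hdecay := norm_le_of_uniform_halving hL (pow_pos hlam0 N)
      (pow_le_one₀ hlam0.le hlam1.le) (by rw [← pow_mul, hlam]) (hbound _ hlast) hhalf
    have hn1 : 1 ≤ √(n : ℝ) := Real.one_le_sqrt.2 (by exact_mod_cast hn)
    have hlamN : lam ^ N ≤ 1 := pow_le_one₀ hlam0.le hlam1.le
    have hLM : 1 ≤ L ^ M := one_le_pow₀ hL
    have hK : 1 ≤ L * (2 * L ^ M) := by nlinarith
    have hKn : 1 ≤ √(n : ℝ) * (L * (2 * L ^ M)) := by nlinarith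
    have hc : 1 ≤ √(n : ℝ) * (L * (2 * L ^ M)) / lam ^ N :=
      (one_le_div (by positivity)).2 (hlamN.trans hKn)
    refine ⟨_, hc, lam, ⟨hlam0, hlam1⟩, fun x hx t => ?_⟩
    rcases t with _ | t
    · simpa using le_mul_of_one_le_left (eNorm_nonneg (x 0)) hc
    have hk : t % N < N := Nat.mod_lt t hN
    obtain ⟨Φ, hΦ, ht⟩ := hx (t / N) (t % N) hk
    have htN : t / N * N + t % N = t := Nat.div_add_mod' t N
    rw [htN] at ht
    have hy : ∀ m, ∃ Φ ∈ D (N - 1), x ((m + 1) * N) = Φ *ᵥ x (m * N) := fun m => by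
      have h := hx m (N - 1) hlast
      rwa [add_assoc, Nat.sub_add_cancel hN, ← Nat.succ_mul] at h
    have hm := hdecay (t / N) (fun m => x (m * N)) hy
    simp only [zero_mul, ← pow_mul] at hm
    have hpow : lam ^ (N * (t / N)) ≤ lam ^ (t + 1) / lam ^ N := by
      rw [le_div_iff₀ (by positivity), ← pow_add]
      refine pow_le_pow_of_le_one hlam0.le hlam1.le ?_
      rw [mul_comm]
      omega
    calc eNorm (x (t + 1)) ≤ √n * ‖x (t + 1)‖ := eNorm_le_mul_norm _
      _ ≤ √n * (L * (2 * L ^ M * (lam ^ (t + 1) / lam ^ N) * eNorm (x 0))) := by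
        rw [ht]
        gcongr
        refine (hbound _ hk Φ hΦ _).trans ?_
        gcongr
        refine hm.trans ?_
        gcongr
        exact norm_le_eNorm _
      _ = √n * (L * (2 * L ^ M)) / lam ^ N * lam ^ (t + 1) * eNorm (x 0) := by ring
  · rintro ⟨c, -, lam, ⟨hlam0, hlam1⟩, hstab⟩ x hx
    have hlim : Tendsto (fun t => c * lam ^ t * eNorm (x 0)) atTop (𝓝 0) := by
      simpa using ((tendsto_pow_atTop_nhds_zero_of_lt_one hlam0.le hlam1).const_mul c).mul_const
        (eNorm (x 0))
    exact squeeze_zero_norm (fun t => (norm_le_eNorm _).trans (hstab x hx t)) hlim
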